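/- If λ > 0 is such that ∑_{n≥1} (Δu_n)² ≥ λ ∑_{n≥2} u_n²/n⁴ holds for all finitely supported real sequences u with u_0 = u_1 = 0, then for every smooth compactly supported function φ on (0,∞), ∫_0^∞ |φ''(x)|² dx ≥ λ ∫_0^∞ φ(x)²/x⁴ dx. Consequently λ ≤ 9/16. -/

import Mathlib

open MeasureTheory Set

lemma aux_cs (f : ℝ → ℝ) (hf : Continuous f) :
    (∫ s in (0:ℝ)..1, f s) ^ 2 ≤ ∫ s in (0:ℝ)..1, f s ^ 2 := by
  set m := ∫ s in (0:ℝ)..1, f s with hm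
  have h0 : 0 ≤ ∫ s in (0:ℝ)..1, (f s - m) ^ 2 :=
    intervalIntegral.integral_nonneg (by norm_num) (fun s _ => sq_nonneg _)
  have h1 : ∫ s in (0:ℝ)..1, (f s - m) ^ 2 = (∫ s in (0:ℝ)..1, f s ^ 2) - m ^ 2 := by
    have : ∀ s, (f s - m) ^ 2 = f s ^ 2 - (2 * m * f s - m ^ 2) := fun s => by ring
    simp_rw [this]
    rw [intervalIntegral.integral_sub, intervalIntegral.integral_sub,
      intervalIntegral.integral_const_mul, ← hm]
    · simp; ring
    all_goals apply Continuous.intervalIntegrable; fun_prop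
  linarith

lemma aux_exists_interval (f : ℝ → ℝ) (hc : HasCompactSupport f) :
    ∃ R : ℝ, 0 < R ∧ (∀ x, R < |x| → f x = 0) := by
  obtain ⟨R, hR⟩ := hc.isCompact.isBounded.subset_closedBall (0:ℝ)
  refine ⟨max R 1, by positivity, fun x hx => ?_⟩
  by_contra h
  have := hR (subset_tsupport f h)
  simp at this
  have := (le_max_left R 1)
  linarith

lemma aux_interval (f : ℝ → ℝ) (a b : ℝ) (hab : a ≤ b) (h : ∀ x, x ∉ Ioc a b → f x = 0) :
    ∫ x in a..b, f x = ∫ x, f x := by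
  rw [intervalIntegral.integral_of_le hab]
  exact setIntegral_eq_integral_of_forall_compl_eq_zero h

lemma aux_le (f : ℝ → ℝ) (hf : Integrable f) (h0 : ∀ x, 0 ≤ f x) (a b : ℝ) (hab : a ≤ b) :
    ∫ x in a..b, f x ≤ ∫ x, f x := by
  rw [intervalIntegral.integral_of_le hab]
  exact setIntegral_le_integral hf (Filter.Eventually.of_forall h0)

lemma aux_diff (p q : ℝ → ℝ) (hd : ∀ x, HasDerivAt p (q x) x) (hq : Continuous q)
    (hpc : HasCompactSupport p) (hqc : HasCompactSupport q) :
    ∫ x, (p (x + 1) - p x) ^ 2 ≤ ∫ x, q x ^ 2 := by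
  obtain ⟨R, hR, hp⟩ := aux_exists_interval p hpc
  have hpcont : Continuous p := continuous_iff_continuousAt.2 fun x => (hd x).continuousAt
  have hqi : Integrable (fun x => q x ^ 2) := by
    apply Continuous.integrable_of_hasCompactSupport (by fun_prop)
    exact hqc.comp_left (g := fun y => y ^ 2) (by simp)
  have hpt : ∀ x, (p (x + 1) - p x) ^ 2 ≤ ∫ s in (0:ℝ)..1, q (x + s) ^ 2 := by
    intro x
    have : ∫ s in (0:ℝ)..1, q (x + s) = p (x + 1) - p x := by
      rw [intervalIntegral.integral_comp_add_left]
      rw [intervalIntegral.integral_eq_sub_of_hasDerivAt (f := p)]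
      · simp
      · intro y _; exact hd y
      · exact hq.intervalIntegrable _ _
    rw [← this]
    exact aux_cs _ (by fun_prop)
  calc ∫ x, (p (x + 1) - p x) ^ 2 = ∫ x in (-R-2)..(R+2), (p (x + 1) - p x) ^ 2 := by
        symm
        apply aux_interval _ _ _ (by linarith)
        intro x hx
        have hx' : x ≤ -R-2 ∨ R + 2 < x := by
          by_contra hh
          push Not at hh
          exact hx hh
        rw [hp, hp]
        · simp
        · rcases hx' with h | h
          · rw [abs_of_nonpos] <;> linarith
          · rw [abs_of_nonneg] <;> linarith
        · rcases hx' with h | h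
          · rw [abs_of_nonpos] <;> linarith
          · rw [abs_of_nonneg] <;> linarith
    _ ≤ ∫ x in (-R-2)..(R+2), ∫ s in (0:ℝ)..1, q (x + s) ^ 2 := by
        apply intervalIntegral.integral_mono_on (by linarith)
        · apply Continuous.intervalIntegrable; fun_prop
        · apply Continuous.intervalIntegrable
          apply intervalIntegral.continuous_parametric_intervalIntegral_of_continuous'
          fun_prop
        · intro x _; exact hpt x
    _ = ∫ s in (0:ℝ)..1, ∫ x in (-R-2)..(R+2), q (x + s) ^ 2 := by
        apply intervalIntegral_intervalIntegral_swap
        have hcont : Continuous (Function.uncurry fun x s : ℝ => q (x + s) ^ 2) := by fun_prop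
        refine IntegrableOn.mono_set (t := uIcc (-R-2) (R+2) ×ˢ uIcc 0 1) ?_ ?_
        · exact hcont.continuousOn.integrableOn_compact (isCompact_uIcc.prod isCompact_uIcc)
        · exact prod_mono uIoc_subset_uIcc uIoc_subset_uIcc
    _ ≤ ∫ s in (0:ℝ)..1, ∫ x, q x ^ 2 := by
        apply intervalIntegral.integral_mono_on (by norm_num)
        · apply Continuous.intervalIntegrable
          apply intervalIntegral.continuous_parametric_intervalIntegral_of_continuous'
          fun_prop
        · simp
        · intro s _
          rw [intervalIntegral.integral_comp_add_right (fun x => q x ^ 2)]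
          exact aux_le _ hqi (fun x => sq_nonneg _) _ _ (by linarith)
    _ = ∫ x, q x ^ 2 := by simp

lemma aux_diff2 (f f' f'' : ℝ → ℝ) (hd : ∀ x, HasDerivAt f (f' x) x)
    (hd' : ∀ x, HasDerivAt f' (f'' x) x) (hc : Continuous f'')
    (h0 : HasCompactSupport f) (h1 : HasCompactSupport f') (h2 : HasCompactSupport f'') :
    ∫ x, (2 * f (x + 1) - f (x + 2) - f x) ^ 2 ≤ ∫ x, f'' x ^ 2 := by
  have hs : ∀ g : ℝ → ℝ, HasCompactSupport g → HasCompactSupport (fun x => g (x + 1) - g x) := by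
    intro g hg
    have : HasCompactSupport (fun x => g (x + 1)) :=
      hg.comp_homeomorph (Homeomorph.addRight (1:ℝ))
    exact this.sub hg
  have hc' : Continuous f' := continuous_iff_continuousAt.2 fun x => (hd' x).continuousAt
  have e1 := aux_diff (fun x => f (x + 1) - f x) (fun x => f' (x + 1) - f' x)
    (fun x => ((hd (x + 1)).comp_add_const x 1).sub (hd x)) (by fun_prop) (hs _ h0) (hs _ h1)
  have e2 := aux_diff f' f'' hd' hc h1 h2
  refine le_trans (le_of_eq ?_) (e1.trans e2)
  congr 1; ext x
  rw [show x + 1 + 1 = x + 2 by ring]; ring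

lemma aux_sum (F : ℝ → ℝ) (hF : ContinuousOn F (Ici 0)) (M : ℕ) :
    ∫ t in (0:ℝ)..1, ∑ n ∈ Finset.range M, F (n + t) = ∫ x in (0:ℝ)..M, F x := by
  have hi : ∀ n : ℕ, IntervalIntegrable F volume n ((n + 1 : ℕ) : ℝ) := by
    intro n
    apply ContinuousOn.intervalIntegrable
    apply hF.mono
    rw [uIcc_of_le (by simp)]
    intro x hx
    exact le_trans (Nat.cast_nonneg n) hx.1
  rw [intervalIntegral.integral_finsetSum]
  · have := intervalIntegral.sum_integral_adjacent_intervals (f := F) (μ := volume)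
      (a := fun k : ℕ => (k:ℝ)) (n := M) (fun k _ => hi k)
    simp only [Nat.cast_zero] at this
    rw [← this]
    apply Finset.sum_congr rfl
    intro n _
    rw [intervalIntegral.integral_comp_add_left]
    simp
  · intro n _
    apply ContinuousOn.intervalIntegrable
    apply hF.comp (by fun_prop)
    rw [uIcc_of_le (by simp)]
    intro x hx
    have := hx.1
    simp only [mem_Ici]; positivity

lemma aux_unit (lam : ℝ) (hlam : 0 < lam)
    (hdisc : ∀ u : ℕ → ℝ, (∃ N, ∀ n ≥ N, u n = 0) → u 0 = 0 → u 1 = 0 →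
      ∑' n : ℕ, (2 * u (n + 1) - u (n + 2) - u n) ^ 2 ≥
        lam * ∑' n : ℕ, (u (n + 2)) ^ 2 / ((n : ℝ) + 2) ^ 4)
    (f f' f'' : ℝ → ℝ) (hd : ∀ x, HasDerivAt f (f' x) x)
    (hd' : ∀ x, HasDerivAt f' (f'' x) x) (hc : Continuous f'')
    (h0 : HasCompactSupport f) (h1 : HasCompactSupport f') (h2 : HasCompactSupport f'')
    (hf2 : ∀ x ≤ 2, f x = 0) :
    lam * ∫ x in Ioi (0:ℝ), f x ^ 2 / x ^ 4 ≤ ∫ x, f'' x ^ 2 := by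
  obtain ⟨R, hR, hp⟩ := aux_exists_interval f h0
  obtain ⟨M, hM⟩ := exists_nat_gt R
  have hcf : Continuous f := continuous_iff_continuousAt.2 fun x => (hd x).continuousAt
  have hfM : ∀ x : ℝ, M ≤ x → f x = 0 := fun x hx => hp x (by
    rw [abs_of_nonneg] <;> linarith)
  set D : ℝ → ℝ := fun x => (2 * f (x + 1) - f (x + 2) - f x) ^ 2 with hD
  set E : ℝ → ℝ := fun x => f (x + 2) ^ 2 / (x + 2) ^ 4 with hE
  have hDc : Continuous D := by fun_prop
  have hEc : ContinuousOn E (Ici 0) := by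
    apply ContinuousOn.div (by fun_prop) (by fun_prop)
    intro x hx
    have : (0:ℝ) ≤ x := hx
    positivity
  have hpt : ∀ t ∈ Icc (0:ℝ) 1, lam * ∑ n ∈ Finset.range M, E (n + t) ≤
      ∑ n ∈ Finset.range M, D (n + t) := by
    intro t ht
    have hz : ∀ n : ℕ, M ≤ n → f (n + t) = 0 := fun n hn => hfM _ (by
      have : (M:ℝ) ≤ n := by exact_mod_cast hn
      linarith [ht.1])
    have := hdisc (fun n => f (n + t)) ⟨M, fun n hn => hz n hn⟩
      (hf2 _ (by simp; linarith [ht.2])) (hf2 _ (by push_cast; linarith [ht.2]))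
    rw [tsum_eq_sum (s := Finset.range M), tsum_eq_sum (s := Finset.range M)] at this
    · refine le_trans ?_ (this.trans (le_of_eq ?_))
      · apply mul_le_mul_of_nonneg_left _ hlam.le
        apply Finset.sum_le_sum
        intro n _
        simp only [hE]
        rw [show ((n + 2 : ℕ) : ℝ) + t = n + t + 2 by push_cast; ring]
        have := ht.1
        gcongr
        linarith
      · apply Finset.sum_congr rfl
        intro n _
        simp only [hD]
        rw [show ((n + 2 : ℕ) : ℝ) + t = n + t + 2 by push_cast; ring,
          show ((n + 1 : ℕ) : ℝ) + t = n + t + 1 by push_cast; ring]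
    · intro n hn
      simp only [Finset.mem_range, not_lt] at hn
      rw [hz (n + 2) (by omega)]; simp
    · intro n hn
      simp only [Finset.mem_range, not_lt] at hn
      rw [hz (n + 2) (by omega), hz (n + 1) (by omega), hz n hn]; simp
  have hcs : ∀ F : ℝ → ℝ, ContinuousOn F (Ici 0) →
      IntervalIntegrable (fun t => ∑ n ∈ Finset.range M, F (n + t)) volume 0 1 := by
    intro F hF
    apply ContinuousOn.intervalIntegrable
    apply continuousOn_finsetSum
    intro n _
    apply hF.comp (by fun_prop)
    rw [uIcc_of_le (by simp)]
    intro x hx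
    have := hx.1
    simp only [mem_Ici]; positivity
  have hint : lam * ∫ x in (0:ℝ)..M, E x ≤ ∫ x in (0:ℝ)..M, D x := by
    rw [← aux_sum E hEc, ← aux_sum D hDc.continuousOn, ← intervalIntegral.integral_const_mul]
    exact intervalIntegral.integral_mono_on (by norm_num) ((hcs E hEc).const_mul _)
      (hcs D hDc.continuousOn) hpt
  have hM0 : (0:ℝ) ≤ M := Nat.cast_nonneg _
  have hDi : Integrable D := by
    apply hDc.integrable_of_hasCompactSupport
    apply HasCompactSupport.of_support_subset_isCompact (isCompact_Icc (a := -R-2) (b := R+2))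
    intro x hx
    by_contra hh
    apply hx
    have hx' : x < -R-2 ∨ R + 2 < x := by
      by_contra h3
      push Not at h3
      exact hh h3
    simp only [hD]
    rw [hp (x+1), hp (x+2), hp x]
    · simp
    all_goals
      rcases hx' with h | h
      · rw [abs_of_nonpos] <;> linarith
      · rw [abs_of_nonneg] <;> linarith
  have hE2 : ∫ x in Ioi (0:ℝ), f x ^ 2 / x ^ 4 = ∫ x in (0:ℝ)..M, E x := by
    simp only [hE]
    rw [intervalIntegral.integral_comp_add_right (fun x => f x ^ 2 / x ^ 4)]
    rw [aux_interval _ _ _ (by linarith)]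
    · apply setIntegral_eq_integral_of_forall_compl_eq_zero
      intro x hx
      simp only [mem_Ioi, not_lt] at hx
      rw [hf2 x (by linarith)]; simp
    · intro x hx
      have hx' : x ≤ 2 ∨ M + 2 < x := by
        by_contra h3
        push Not at h3
        exact hx ⟨by linarith [h3.1], h3.2⟩
      rcases hx' with h | h
      · rw [hf2 x h]; simp
      · rw [hfM x (by linarith)]; simp
  rw [hE2]
  exact hint.trans ((aux_le D hDi (fun x => sq_nonneg _) _ _ hM0).trans
    (aux_diff2 f f' f'' hd hd' hc h0 h1 h2))

lemma aux_cont (lam : ℝ) (hlam : 0 < lam)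
    (hdisc : ∀ u : ℕ → ℝ, (∃ N, ∀ n ≥ N, u n = 0) → u 0 = 0 → u 1 = 0 →
      ∑' n : ℕ, (2 * u (n + 1) - u (n + 2) - u n) ^ 2 ≥
        lam * ∑' n : ℕ, (u (n + 2)) ^ 2 / ((n : ℝ) + 2) ^ 4)
    (φ : ℝ → ℝ) (hφ : ContDiff ℝ (⊤ : ℕ∞) φ) (hcs : HasCompactSupport φ)
    (hsup : tsupport φ ⊆ Set.Ioi 0) :
    ∫ x in Set.Ioi (0 : ℝ), (deriv (deriv φ) x) ^ 2 ≥
        lam * ∫ x in Set.Ioi (0 : ℝ), (φ x) ^ 2 / x ^ 4 := by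
  obtain ⟨a, ha, hlow⟩ : ∃ a : ℝ, 0 < a ∧ ∀ x ≤ a, φ x = 0 := by
    rcases (tsupport φ).eq_empty_or_nonempty with h | h
    · refine ⟨1, one_pos, fun x _ => ?_⟩
      by_contra hh
      have := subset_tsupport φ hh
      rw [h] at this; exact this
    · obtain ⟨m, hm, hmin⟩ := hcs.isCompact.exists_isLeast h
      have hm0 : 0 < m := hsup hm
      refine ⟨m / 2, by positivity, fun x hx => ?_⟩
      by_contra hh
      have := hmin (subset_tsupport φ hh)
      linarith
  set h := a / 2 with hh
  have hpos : 0 < h := by positivity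
  have hφ2 : ContDiff ℝ 2 φ := (contDiff_infty.1 hφ) 2
  have hφ1 : ContDiff ℝ 1 (deriv φ) := ((contDiff_succ_iff_deriv (n := 1)).1 hφ2).2.2
  have hφ0 : Continuous (deriv (deriv φ)) := (contDiff_one_iff_deriv.1 hφ1).2
  have hlin : ∀ x : ℝ, HasDerivAt (fun y => h * y) h x := fun x => by
    simpa using (hasDerivAt_id x).const_mul h
  have hd : ∀ x, HasDerivAt (fun x => φ (h * x)) (h * deriv φ (h * x)) x := fun x => by
    have := (hφ2.differentiable (by norm_num) (h * x)).hasDerivAt.comp x (hlin x)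
    rw [mul_comm]; exact this
  have hd' : ∀ x, HasDerivAt (fun x => h * deriv φ (h * x)) (h ^ 2 * deriv (deriv φ) (h * x)) x :=
    fun x => by
      have := ((hφ1.differentiable (by norm_num) (h * x)).hasDerivAt.comp x (hlin x)).const_mul h
      exact this.congr_deriv (by ring)
  have hsc : ∀ (g : ℝ → ℝ) (c : ℝ), HasCompactSupport g →
      HasCompactSupport (fun x => c * g (h * x)) := by
    intro g c hg
    have : HasCompactSupport (fun x => g (h * x)) :=
      hg.comp_homeomorph (Homeomorph.mulLeft₀ h hpos.ne')
    exact this.mul_left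
  have key := aux_unit lam hlam hdisc _ _ _ hd hd' (by fun_prop)
    (by simpa using hsc φ 1 hcs) (hsc _ _ hcs.deriv) (hsc _ _ hcs.deriv.deriv)
    (fun x hx => hlow _ (by rw [hh]; nlinarith))
  have e1 : ∫ x in Ioi (0:ℝ), φ (h * x) ^ 2 / x ^ 4 =
      h ^ 3 * ∫ x in Ioi (0:ℝ), φ x ^ 2 / x ^ 4 := by
    have := integral_comp_mul_left_Ioi (fun x => φ x ^ 2 / x ^ 4) 0 hpos
    rw [mul_zero, smul_eq_mul] at this
    have h2 : ∀ x : ℝ, φ (h * x) ^ 2 / x ^ 4 = h ^ 4 * (φ (h * x) ^ 2 / (h * x) ^ 4) := by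
      intro x
      rw [mul_pow h x 4]
      by_cases hx : x = 0
      · simp [hx]
      · field_simp
    simp_rw [h2]
    rw [integral_const_mul, this]
    field_simp
  have e2 : ∫ x, (h ^ 2 * deriv (deriv φ) (h * x)) ^ 2 =
      h ^ 3 * ∫ x in Ioi (0:ℝ), deriv (deriv φ) x ^ 2 := by
    rw [setIntegral_eq_integral_of_forall_compl_eq_zero]
    · simp_rw [mul_pow]
      rw [integral_const_mul, Measure.integral_comp_mul_left (fun x => deriv (deriv φ) x ^ 2) h,
        abs_of_pos (by positivity), smul_eq_mul]
      field_simp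
    · intro x hx
      have : x ∉ tsupport (deriv (deriv φ)) := fun h3 =>
        hx (hsup (tsupport_deriv_subset (tsupport_deriv_subset h3)))
      rw [image_eq_zero_of_notMem_tsupport this]; simp
  rw [e1, e2] at key
  have h3 : 0 < h ^ 3 := by positivity
  refine le_of_mul_le_mul_left ?_ h3
  linarith

lemma aux_exp_cov (g : ℝ → ℝ) : ∫ x in Ioi (0:ℝ), g x = ∫ s, Real.exp s * g (Real.exp s) := by
  have := integral_image_eq_integral_abs_deriv_smul (s := univ) (f := Real.exp) (f' := Real.exp)
    MeasurableSet.univ (fun x _ => (Real.hasDerivAt_exp x).hasDerivWithinAt)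
    Real.exp_injective.injOn g
  rw [image_univ, Real.range_exp] at this
  rw [this]
  simp

lemma aux_test (lam : ℝ)
    (H : ∀ φ : ℝ → ℝ, ContDiff ℝ (⊤ : ℕ∞) φ → HasCompactSupport φ → tsupport φ ⊆ Set.Ioi 0 →
      ∫ x in Set.Ioi (0 : ℝ), (deriv (deriv φ) x) ^ 2 ≥
        lam * ∫ x in Set.Ioi (0 : ℝ), (φ x) ^ 2 / x ^ 4)
    (χ : ℝ → ℝ) (hχ : ContDiff ℝ (⊤ : ℕ∞) χ) (hc : HasCompactSupport χ) (ε : ℝ) (hε : 0 < ε) :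
    lam * ∫ s, χ s ^ 2 ≤
      ∫ s, (3 / 4 * χ s + 2 * ε * deriv χ s + ε ^ 2 * deriv (deriv χ) s) ^ 2 := by
  obtain ⟨R, hR, hz⟩ := aux_exists_interval χ hc
  have hχ2 : ContDiff ℝ 2 χ := (contDiff_infty.1 hχ) 2
  have hχ1 : ContDiff ℝ 1 (deriv χ) := ((contDiff_succ_iff_deriv (n := 1)).1 hχ2).2.2
  set φ : ℝ → ℝ := fun x => if 0 < x then Real.exp (3 / 2 * Real.log x) * χ (ε * Real.log x) else 0
    with hφdef
  have hsub : tsupport φ ⊆ Real.exp '' Icc (-(R / ε)) (R / ε) := by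
    apply closure_minimal
    · intro x hx
      have hx0 : 0 < x := by
        by_contra h
        exact hx (by simp [hφdef, h])
      refine ⟨Real.log x, ?_, Real.exp_log hx0⟩
      rw [← mem_Icc.symm, ← abs_le, le_div_iff₀ hε]
      by_contra h
      apply hx
      simp only [hφdef]
      rw [hz (ε * Real.log x)]
      · simp
      · rw [abs_mul, abs_of_pos hε]; linarith
    · exact (isCompact_Icc.image Real.continuous_exp).isClosed
  have hpos : tsupport φ ⊆ Ioi 0 := hsub.trans (by
    rintro _ ⟨s, _, rfl⟩; exact Real.exp_pos s)
  have hev : ∀ x : ℝ, 0 < x →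
      φ =ᶠ[nhds x] fun x => Real.exp (3 / 2 * Real.log x) * χ (ε * Real.log x) := by
    intro x hx
    filter_upwards [lt_mem_nhds hx] with y hy
    simp [hφdef, hy]
  have hcomp : HasCompactSupport φ :=
    (isCompact_Icc.image Real.continuous_exp).of_isClosed_subset (isClosed_tsupport φ) hsub
  have hsm : ContDiff ℝ (⊤ : ℕ∞) φ := by
    rw [contDiff_iff_contDiffAt]
    intro x
    by_cases hx : x ∈ tsupport φ
    swap
    · exact contDiffAt_const.congr_of_eventuallyEq (notMem_tsupport_iff_eventuallyEq.1 hx)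
    have hx0 : 0 < x := hpos hx
    refine ContDiffAt.congr_of_eventuallyEq ?_ (hev x hx0)
    have hl : ContDiffAt ℝ (⊤ : ℕ∞) Real.log x := Real.contDiffAt_log.2 hx0.ne'
    exact (contDiffAt_const.mul hl).exp.mul (hχ.contDiffAt.comp x (contDiffAt_const.mul hl))
  have hlg : ∀ (c x : ℝ), 0 < x → HasDerivAt (fun y => c * Real.log y) (c * x⁻¹) x :=
    fun c x hx => (Real.hasDerivAt_log hx.ne').const_mul c
  have hex : ∀ (c x : ℝ), 0 < x →
      HasDerivAt (fun y => Real.exp (c * Real.log y)) (Real.exp (c * Real.log x) * (c * x⁻¹)) x :=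
    fun c x hx => (hlg c x hx).exp
  have hch : ∀ x, 0 < x → HasDerivAt (fun y => χ (ε * Real.log y))
      (deriv χ (ε * Real.log x) * (ε * x⁻¹)) x := fun x hx =>
    (hχ2.differentiable (by norm_num) (ε * Real.log x)).hasDerivAt.comp x (hlg ε x hx)
  have hch' : ∀ x, 0 < x → HasDerivAt (fun y => deriv χ (ε * Real.log y))
      (deriv (deriv χ) (ε * Real.log x) * (ε * x⁻¹)) x := fun x hx =>
    HasDerivAt.comp (h₂ := deriv χ) x
      (hχ1.differentiable (by norm_num) (ε * Real.log x)).hasDerivAt (hlg ε x hx)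
  have hd1 : ∀ x : ℝ, 0 < x → deriv φ x = Real.exp (3 / 2 * Real.log x) * x⁻¹ *
      (3 / 2 * χ (ε * Real.log x) + ε * deriv χ (ε * Real.log x)) := by
    intro x hx
    rw [(hev x hx).deriv_eq]
    refine (((hex (3 / 2) x hx).mul (hch x hx)).congr_deriv ?_).deriv
    ring
  have hd2 : ∀ x : ℝ, 0 < x → deriv (deriv φ) x = Real.exp (3 / 2 * Real.log x) * x⁻¹ ^ 2 *
      (3 / 4 * χ (ε * Real.log x) + 2 * ε * deriv χ (ε * Real.log x) +
        ε ^ 2 * deriv (deriv χ) (ε * Real.log x)) := by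
    intro x hx
    have : deriv φ =ᶠ[nhds x] fun x => Real.exp (3 / 2 * Real.log x) * x⁻¹ *
        (3 / 2 * χ (ε * Real.log x) + ε * deriv χ (ε * Real.log x)) := by
      filter_upwards [lt_mem_nhds hx] with y hy using hd1 y hy
    rw [this.deriv_eq]
    refine ((((hex (3 / 2) x hx).mul (hasDerivAt_inv hx.ne')).mul
      (((hch x hx).const_mul (3 / 2)).add ((hch' x hx).const_mul ε))).congr_deriv ?_).deriv
    simp only [Pi.mul_apply, Pi.add_apply]
    field_simp
    ring
  have key := H φ hsm hcomp hpos
  rw [aux_exp_cov, aux_exp_cov] at key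
  have he : ∀ s : ℝ, Real.exp s * (Real.exp (3 / 2 * s)) ^ 2 = Real.exp s ^ 4 := by
    intro s
    rw [← Real.exp_nat_mul, ← Real.exp_nat_mul, ← Real.exp_add]
    congr 1; push_cast; ring
  have e1 : ∀ s : ℝ, Real.exp s * (φ (Real.exp s) ^ 2 / Real.exp s ^ 4) =
      (fun s => χ s ^ 2) (ε * s) := by
    intro s
    have h1 : φ (Real.exp s) = Real.exp (3 / 2 * s) * χ (ε * s) := by
      simp [hφdef, Real.exp_pos]
    have h2 := he s
    have h3 : Real.exp s ^ 4 ≠ 0 := by positivity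
    rw [h1, ← mul_div_assoc, div_eq_iff h3, ← h2]
    ring
  have e2 : ∀ s : ℝ, Real.exp s * deriv (deriv φ) (Real.exp s) ^ 2 =
      (fun s => (3 / 4 * χ s + 2 * ε * deriv χ s + ε ^ 2 * deriv (deriv χ) s) ^ 2) (ε * s) := by
    intro s
    have h3 : Real.exp s ≠ 0 := (Real.exp_pos s).ne'
    rw [hd2 _ (Real.exp_pos s), Real.log_exp]
    rw [mul_pow, mul_pow, ← mul_assoc, ← mul_assoc, he s]
    field_simp
  simp_rw [e1, e2] at key
  rw [Measure.integral_comp_mul_left (fun s => χ s ^ 2) ε,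
    Measure.integral_comp_mul_left (fun s =>
      (3 / 4 * χ s + 2 * ε * deriv χ s + ε ^ 2 * deriv (deriv χ) s) ^ 2) ε,
    abs_of_pos (by positivity), smul_eq_mul, smul_eq_mul] at key
  refine le_of_mul_le_mul_left ?_ (inv_pos.2 hε)
  linarith

lemma aux_const (lam : ℝ)
    (H : ∀ φ : ℝ → ℝ, ContDiff ℝ (⊤ : ℕ∞) φ → HasCompactSupport φ → tsupport φ ⊆ Set.Ioi 0 →
      ∫ x in Set.Ioi (0 : ℝ), (deriv (deriv φ) x) ^ 2 ≥
        lam * ∫ x in Set.Ioi (0 : ℝ), (φ x) ^ 2 / x ^ 4) : lam ≤ 9 / 16 := by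
  let b : ContDiffBump (0:ℝ) := default
  set χ : ℝ → ℝ := fun x => b x with hχdef
  have hχ : ContDiff ℝ (⊤ : ℕ∞) χ := b.contDiff
  have hc : HasCompactSupport χ := b.hasCompactSupport
  have hχ2 : ContDiff ℝ 2 χ := (contDiff_infty.1 hχ) 2
  have hχ1 : ContDiff ℝ 1 (deriv χ) := ((contDiff_succ_iff_deriv (n := 1)).1 hχ2).2.2
  have c0 : Continuous χ := hχ.continuous
  have c1 : Continuous (deriv χ) := hχ1.continuous
  have c2 : Continuous (deriv (deriv χ)) := (contDiff_one_iff_deriv.1 hχ1).2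
  have hI : 0 < ∫ s, χ s ^ 2 := by
    apply Continuous.integral_pos_of_hasCompactSupport_nonneg_nonzero (x := 0) (by fun_prop)
    · exact hc.comp_left (g := fun y => y ^ 2) (by simp)
    · intro x; exact sq_nonneg _
    · have : χ 0 = 1 := b.one_of_mem_closedBall (by simp [b.rIn_pos.le])
      simp [this]
  have hmul : ∀ f g : ℝ → ℝ, Continuous f → Continuous g → HasCompactSupport f →
      Integrable (fun x => f x * g x) := fun f g hf hg hfc =>
    (hf.mul hg).integrable_of_hasCompactSupport hfc.mul_right
  set p : ℝ → ℝ := fun ε => 9 / 16 * (∫ s, χ s ^ 2) + ε * (3 * ∫ s, χ s * deriv χ s)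
    + ε ^ 2 * (∫ s, χ s * (3 / 2 * deriv (deriv χ) s) + deriv χ s * (4 * deriv χ s))
    + ε ^ 3 * (4 * ∫ s, deriv χ s * deriv (deriv χ) s)
    + ε ^ 4 * ∫ s, deriv (deriv χ) s * deriv (deriv χ) s with hp
  have hpe : ∀ ε, 0 < ε → lam * ∫ s, χ s ^ 2 ≤ p ε := by
    intro ε hε
    refine (aux_test lam H χ hχ hc ε hε).trans (le_of_eq ?_)
    have i0 : Integrable (fun s => χ s ^ 2) := by
      simpa [pow_two] using hmul χ χ c0 c0 hc
    have i1 := hmul _ _ c0 c1 hc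
    have i2 : Integrable (fun s => χ s * (3 / 2 * deriv (deriv χ) s) + deriv χ s * (4 * deriv χ s)) :=
      (hmul _ _ c0 (c2.const_mul _) hc).add (hmul _ _ c1 (c1.const_mul _) hc.deriv)
    have i3 := hmul _ _ c1 c2 hc.deriv
    have i4 := hmul _ _ c2 c2 hc.deriv.deriv
    simp only [hp]
    rw [← integral_const_mul, ← integral_const_mul, ← integral_const_mul, ← integral_const_mul,
      ← integral_const_mul, ← integral_const_mul, ← integral_const_mul,
      ← integral_add, ← integral_add, ← integral_add, ← integral_add]
    · congr 1; ext s; ring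
    all_goals fun_prop
  have hcont : Continuous p := by fun_prop
  have hp0 : p 0 = 9 / 16 * ∫ s, χ s ^ 2 := by simp [hp]
  have ht : Filter.Tendsto p (nhdsWithin 0 (Ioi 0)) (nhds (p 0)) :=
    (hcont.tendsto 0).mono_left nhdsWithin_le_nhds
  have := ge_of_tendsto ht (Filter.eventually_of_mem self_mem_nhdsWithin fun ε hε => hpe ε hε)
  rw [hp0] at this
  exact le_of_mul_le_mul_right this hI


/-- If the second order discrete Rellich inequality holds with constant `λ > 0`,
then the continuous Rellich inequality on `(0,∞)` holds with the same constant,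
and consequently `λ ≤ 9/16`. -/
theorem discrete_implies_continuous_rellich (lam : ℝ) (hlam : 0 < lam)
    (hdisc : ∀ u : ℕ → ℝ, (∃ N, ∀ n ≥ N, u n = 0) → u 0 = 0 → u 1 = 0 →
      ∑' n : ℕ, (2 * u (n + 1) - u (n + 2) - u n) ^ 2 ≥
        lam * ∑' n : ℕ, (u (n + 2)) ^ 2 / ((n : ℝ) + 2) ^ 4) :
    (∀ φ : ℝ → ℝ, ContDiff ℝ (⊤ : ℕ∞) φ → HasCompactSupport φ → tsupport φ ⊆ Set.Ioi 0 →
      ∫ x in Set.Ioi (0 : ℝ), (deriv (deriv φ) x) ^ 2 ≥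
        lam * ∫ x in Set.Ioi (0 : ℝ), (φ x) ^ 2 / x ^ 4) ∧
    lam ≤ 9 / 16 := by
  have H := aux_cont lam hlam hdisc
  exact ⟨H, aux_const lam H⟩
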